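/- Under the bijection ϕ, the Lalanne–Kreweras involution L on Dyck n-paths corresponds to reflection of path pairs in a 45° line: for every Dyck n-path P, ϕ(L(P)) is the path pair obtained from ϕ(P) by the reflection interchanging the two coordinate directions (which swaps N steps with E steps and interchanges the upper and lower paths). -/

import Mathlib

/-- A Dyck path, encoded as a list of steps: `true` = upstep `u`, `false` = downstep `d`. -/
def IsDyck (p : List Bool) : Prop :=
  p.count true = p.count false ∧ ∀ q : List Bool, q <+: p → q.count false ≤ q.count true

/-- A Dyck `n`-path: a Dyck path with `n` upsteps (and `n` downsteps). -/
def IsDyckN (n : ℕ) (p : List Bool) : Prop := IsDyck p ∧ p.count true = n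

/-- The (0-indexed) positions `j` such that step `j` is `a` and step `j+1` is `b`. -/
def adjPositions (a b : Bool) (p : List Bool) : List ℕ :=
  (List.range p.length).filter (fun j => p[j]? == some a && p[j+1]? == some b)

/-- Labels of the first downstep of each occurrence of `dd` (downsteps labelled left to
right by 1, 2, …). -/
def lkA (p : List Bool) : List ℕ :=
  (adjPositions false false p).map (fun j => (p.take (j+1)).count false)

/-- Labels of the first upstep of each occurrence of `uu` (upsteps labelled left to
right by 1, 2, …). -/
def lkD (p : List Bool) : List ℕ :=
  (adjPositions true true p).map (fun j => (p.take (j+1)).count true)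

/-- The Dyck path of size `n` whose partial-sum ascent-descent code is `(A, D)`:
its ascent lengths are the successive differences of `A ++ [n]`, and its descent
lengths are the successive differences of `D ++ [n]`. -/
def pathOfCode (n : ℕ) (A D : List ℕ) : List Bool :=
  let A' := A ++ [n]
  let D' := D ++ [n]
  let a := List.zipWith (· - ·) A' (0 :: A')
  let d := List.zipWith (· - ·) D' (0 :: D')
  (List.zipWith (fun x y => List.replicate x true ++ List.replicate y false) a d).flatten

/-- The Lalanne–Kreweras involution `L` on Dyck paths: the image is the Dyck path
whose partial-sum ascent-descent code is `(lkA p, lkD p)`. -/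
def Lmap (p : List Bool) : List Bool := pathOfCode (p.count true) (lkA p) (lkD p)

/-- A nonintersecting path pair of size `m`, encoded as a pair of lists of steps
(`true` = north step `N`, `false` = east step `E`) from a common initial point to a
common terminal point: the two paths intersect only at the initial and terminal points,
with the first path (the upper path) lying above the second (at every interior step
index `j`, the vertex of the upper path is strictly above that of the lower path). -/
def IsPathPair (m : ℕ) (P : List Bool × List Bool) : Prop :=
  P.1.length = m ∧ P.2.length = m ∧ P.1.count true = P.2.count true ∧
  ∀ j, 0 < j → j < m → (P.2.take j).count true < (P.1.take j).count true

/-- The upper path of `φ p`: the ascents of the elevated path `u p d`, each written as a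
run of `N` steps whose last step is changed to an `E` step, concatenated. -/
def phiUpper (p : List Bool) : List Bool :=
  let ep := true :: (p ++ [false])
  ((List.range ep.length).filter (fun j => ep.getD j false)).map (fun j => ep.getD (j+1) false)

/-- The path `X`: the descents of the elevated path `u p d`, each written as a run of `N`
steps whose last step is changed to an `E` step, concatenated. -/
def phiX (p : List Bool) : List Bool :=
  let ep := true :: (p ++ [false])
  ((List.range ep.length).filter (fun j => !(ep.getD j true))).map
    (fun j => ep[j+1]? == some false)

/-- The bijection `φ` from Dyck `n`-paths to nonintersecting path pairs of size `n + 1`: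
the upper path comes from the ascents of the elevated path, and the lower path is `X`
(from the descents) with its last step (necessarily an `E`) transferred to the start. -/
def phi (p : List Bool) : List Bool × List Bool :=
  (phiUpper p, (phiX p).getLastD false :: (phiX p).dropLast)

/-- For each occurrence of `a` in the list, record whether it is followed by another `a`. -/
def followBits (a : Bool) : List Bool → List Bool
  | [] => []
  | x :: l => if x = a then (l.head? == some a) :: followBits a l else followBits a l

/-- The positions, counted from `k + 1`, of the entries `true`. -/
def truePositions (k : ℕ) : List Bool → List ℕ
  | [] => []
  | x :: l => if x then (k + 1) :: truePositions (k + 1) l else truePositions (k + 1) l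

/-- A run of length `x`, written as `N` steps with the last one changed to `E`. -/
def runBlock (x : ℕ) : List Bool := List.replicate (x - 1) true ++ [false]

/-- The path with ascent lengths `a` and descent lengths `d`. -/
def pathOfRuns (a d : List ℕ) : List Bool :=
  (List.zipWith (fun x y => List.replicate x true ++ List.replicate y false) a d).flatten

theorem followBits_eq_map_range (a : Bool) (l : List Bool) :
    ((List.range l.length).filter (fun j => l[j]? == some a)).map
      (fun j => l[j+1]? == some a) = followBits a l := by
  induction l with
  | nil => rfl
  | cons x l ih =>
    rw [List.length_cons, List.range_succ_eq_map, List.filter_cons, List.filter_map, followBits,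
      ← ih]
    by_cases hx : x = a <;> simp [hx, Function.comp_def, List.head?_eq_getElem?]

theorem map_count_adjPositions (a : Bool) (l : List Bool) (k : ℕ) :
    (adjPositions a a l).map (fun j => k + (l.take (j+1)).count a)
      = truePositions k (followBits a l) := by
  induction l generalizing k with
  | nil => rfl
  | cons x l ih =>
    unfold adjPositions at ih ⊢
    rw [List.length_cons, List.range_succ_eq_map, List.filter_cons, List.filter_map, followBits]
    by_cases hx : x = a
    · have h := ih (k + 1)
      by_cases hy : l.head? = some a
      · have hz := hy
        rw [List.head?_eq_getElem?] at hz
        simp [hx, hy, hz, truePositions, ← h, Function.comp_def]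
        intros; omega
      · have hz := hy
        rw [List.head?_eq_getElem?] at hz
        simp [hx, hy, hz, truePositions, ← h, Function.comp_def]
        intros; omega
    · simp [hx, ← ih k, Function.comp_def]

theorem lkA_eq (p : List Bool) : lkA p = truePositions 0 (followBits false p) := by
  simp [lkA, ← map_count_adjPositions]

theorem lkD_eq (p : List Bool) : lkD p = truePositions 0 (followBits true p) := by
  simp [lkD, ← map_count_adjPositions]

theorem phiUpper_eq (p : List Bool) :
    phiUpper p = followBits true (true :: (p ++ [false])) := by
  rw [← followBits_eq_map_range, phiUpper]
  have h (l : List Bool) (j : ℕ) : l.getD j false = (l[j]? == some true) := by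
    rw [List.getD_eq_getElem?_getD]
    rcases l[j]? with _ | _ | _ <;> rfl
  simp only [h]

theorem phiX_eq (p : List Bool) :
    phiX p = followBits false (true :: (p ++ [false])) := by
  rw [← followBits_eq_map_range, phiX]
  have h (l : List Bool) (j : ℕ) : (!(l.getD j true)) = (l[j]? == some false) := by
    rw [List.getD_eq_getElem?_getD]
    rcases l[j]? with _ | _ | _ <;> rfl
  simp only [h]

theorem followBits_append_not (a : Bool) (l : List Bool) :
    followBits a (l ++ [!a]) = followBits a l := by
  induction l with
  | nil => cases a <;> rfl
  | cons x l ih => cases l <;> cases a <;> simp_all [followBits]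

theorem followBits_concat_concat (a : Bool) (l : List Bool) :
    ∃ V, followBits a (l ++ [a]) = V ++ [false] ∧
      followBits a (l ++ [a] ++ [a]) = V ++ [true] ++ [false] := by
  induction l with
  | nil => exact ⟨[], by simp [followBits]⟩
  | cons x l ih =>
    obtain ⟨V, h₁, h₂⟩ := ih
    by_cases hx : x = a
    · refine ⟨((l ++ [a]).head? == some a) :: V, ?_⟩
      cases l <;> simp_all [followBits]
    · exact ⟨V, by simp_all [followBits]⟩

theorem length_followBits (a : Bool) (l : List Bool) :
    (followBits a l).length = l.count a := by
  induction l with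
  | nil => rfl
  | cons x l ih => by_cases hx : x = a <;> simp [followBits, hx, ih]

theorem followBits_eq_concat (a : Bool) (l : List Bool) (h : a ∈ l) :
    ∃ V, followBits a l = V ++ [false] := by
  induction l with
  | nil => simp at h
  | cons x l ih =>
    by_cases hl : a ∈ l
    · obtain ⟨V, hV⟩ := ih hl
      by_cases hx : x = a
      · exact ⟨(l.head? == some a) :: V, by simp [followBits, hx, hV]⟩
      · exact ⟨V, by simp [followBits, hx, hV]⟩
    · have hx : x = a := by simp_all
      have h0 : followBits a l = [] := by
        rw [← List.length_eq_zero_iff, length_followBits, List.count_eq_zero_of_not_mem hl]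
      refine ⟨[], ?_⟩
      cases l <;> simp_all [followBits]
      tauto

/-- Ascents and descents alternate. -/
theorem count_false_followBits (l : List Bool) :
    (followBits true (l ++ [false])).count false +
        (if (l ++ [false]).head? = some true then 0 else 1)
      = (followBits false (l ++ [false])).count false := by
  induction l with
  | nil => rfl
  | cons x l ih =>
    have hd : ∃ y, (l ++ [false]).head? = some y := by cases l <;> simp
    obtain ⟨y, hy⟩ := hd
    cases x <;> cases y <;> simp_all [followBits]

theorem phi_eq_of_head_of_last (q V : List Bool) (hh : q.head? = some true)
    (hl : q.getLast? = some false) (hV : followBits false q = V ++ [false]) :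
    phi q = (true :: followBits true q, false :: (V ++ [true])) := by
  obtain ⟨r, rfl⟩ : ∃ r, q = r ++ [false] := by
    rw [List.getLast?_eq_some_iff] at hl
    exact hl
  obtain ⟨W, h₁, h₂⟩ := followBits_concat_concat false r
  obtain rfl : V = W := by simpa [hV] using h₁
  have hU : phiUpper (r ++ [false]) = true :: followBits true (r ++ [false]) := by
    have h := followBits_append_not true (r ++ [false])
    simp only [Bool.not_true] at h
    rw [phiUpper_eq, followBits, h]
    cases r <;> simp_all
  have hX : phiX (r ++ [false]) = V ++ [true] ++ [false] := by
    rw [phiX_eq, followBits, h₂]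
    simp
  rw [phi, hU, hX, List.getLastD_concat, List.dropLast_concat]

theorem truePositions_append_false (k : ℕ) (V : List Bool) :
    truePositions k (V ++ [false]) = truePositions k V := by
  induction V generalizing k with
  | nil => rfl
  | cons x V ih => simp [truePositions, ih]

theorem length_truePositions (k : ℕ) (V : List Bool) :
    (truePositions k V).length = V.count true := by
  induction V generalizing k with
  | nil => rfl
  | cons x V ih => cases x <;> simp [truePositions, ih]

/-- The successive differences of the positions of `true` in `V` are positive, and are the run
lengths encoded by the complement of `V`. -/
theorem diffs_truePositions (V : List Bool) (s k n : ℕ) (hs : s ≤ k) (hn : n = k + V.length + 1) :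
    (∀ x ∈ List.zipWith (· - ·) (truePositions k V ++ [n]) (s :: (truePositions k V ++ [n])),
        0 < x) ∧
      (List.zipWith (· - ·) (truePositions k V ++ [n])
          (s :: (truePositions k V ++ [n]))).flatMap runBlock
        = List.replicate (k - s) true ++ V.map (fun b => !b) ++ [false] := by
  induction V generalizing s k with
  | nil =>
    subst hn
    have h : k + 1 - s - 1 = k - s := by omega
    simp [truePositions, runBlock, h]
    omega
  | cons x V ih =>
    rw [List.length_cons] at hn
    cases x with
    | false =>
      obtain ⟨h₁, h₂⟩ := ih s (k + 1) (by omega) (by omega)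
      refine ⟨by simpa [truePositions] using h₁, ?_⟩
      have h : k + 1 - s = (k - s) + 1 := by omega
      rw [h, List.replicate_succ'] at h₂
      simpa [truePositions] using h₂
    | true =>
      obtain ⟨h₁, h₂⟩ := ih (k + 1) (k + 1) le_rfl (by omega)
      have h : k + 1 - s - 1 = k - s := by omega
      refine ⟨?_, ?_⟩
      · simp only [truePositions, if_true, List.cons_append, List.zipWith_cons_cons,
          List.forall_mem_cons]
        exact ⟨by omega, h₁⟩
      · simp only [truePositions, if_true, List.cons_append, List.zipWith_cons_cons,
          List.flatMap_cons, h₂]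
        simp [runBlock, h]

theorem followBits_replicate_append (a : Bool) (x : ℕ) (hx : 0 < x) (r : List Bool)
    (hr : r.head? ≠ some a) :
    followBits a (List.replicate x a ++ r) = runBlock x ++ followBits a r := by
  induction x, hx using Nat.le_induction with
  | base => simp [followBits, runBlock, hr]
  | succ m hm ih =>
    obtain ⟨m, rfl⟩ : ∃ j, m = j + 1 := ⟨m - 1, by omega⟩
    rw [List.replicate_succ, List.cons_append, followBits, ih]
    simp [runBlock, List.replicate_succ]

theorem followBits_replicate_of_ne (a b : Bool) (hab : b ≠ a) (x : ℕ) (r : List Bool) :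
    followBits a (List.replicate x b ++ r) = followBits a r := by
  induction x with
  | zero => simp
  | succ m ih => simp [List.replicate_succ, followBits, hab, ih]

theorem head?_replicate_append (b : Bool) (x : ℕ) (hx : 0 < x) (r : List Bool) :
    (List.replicate x b ++ r).head? = some b := by
  obtain ⟨m, rfl⟩ : ∃ j, x = j + 1 := ⟨x - 1, by omega⟩
  simp [List.replicate_succ]

theorem pathOfRuns_cons_cons (x y : ℕ) (a d : List ℕ) :
    pathOfRuns (x :: a) (y :: d)
      = List.replicate x true ++ (List.replicate y false ++ pathOfRuns a d) := by
  simp [pathOfRuns]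

theorem head?_pathOfRuns_ne_false (a d : List ℕ) (ha : ∀ x ∈ a, 0 < x) :
    (pathOfRuns a d).head? ≠ some false := by
  match a, d with
  | [], _ => simp [pathOfRuns]
  | _ :: _, [] => simp [pathOfRuns]
  | x :: a, y :: d =>
    rw [pathOfRuns_cons_cons, head?_replicate_append _ _ (ha x (by simp))]
    simp

theorem followBits_pathOfRuns (a d : List ℕ) (hlen : a.length = d.length)
    (ha : ∀ x ∈ a, 0 < x) (hd : ∀ x ∈ d, 0 < x) :
    followBits true (pathOfRuns a d) = a.flatMap runBlock ∧
      followBits false (pathOfRuns a d) = d.flatMap runBlock := by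
  induction a generalizing d with
  | nil =>
    obtain rfl : d = [] := by simpa using hlen.symm
    simp [pathOfRuns, followBits]
  | cons x a ih =>
    obtain _ | ⟨y, d⟩ := d
    · simp at hlen
    · rw [List.forall_mem_cons] at ha hd
      obtain ⟨h₁, h₂⟩ := ih d (by simpa using hlen) ha.2 hd.2
      rw [pathOfRuns_cons_cons, List.flatMap_cons, List.flatMap_cons]
      constructor
      · rw [followBits_replicate_append _ _ ha.1, followBits_replicate_of_ne _ _ (by simp), h₁]
        simp [head?_replicate_append _ _ hd.1]
      · rw [followBits_replicate_of_ne _ _ (by simp), followBits_replicate_append _ _ hd.1 _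
          (head?_pathOfRuns_ne_false a d ha.2), h₂]

theorem getLast?_pathOfRuns (a d : List ℕ) (hlen : a.length = d.length) (hne : a ≠ [])
    (hd : ∀ x ∈ d, 0 < x) : (pathOfRuns a d).getLast? = some false := by
  induction a generalizing d with
  | nil => simp at hne
  | cons x a ih =>
    obtain _ | ⟨y, d⟩ := d
    · simp at hlen
    · rw [List.forall_mem_cons] at hd
      rw [pathOfRuns_cons_cons]
      obtain rfl | ha := eq_or_ne a []
      · obtain rfl : d = [] := by simpa using hlen.symm
        obtain ⟨m, rfl⟩ : ∃ j, y = j + 1 := ⟨y - 1, by omega⟩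
        simp [pathOfRuns, List.replicate_succ']
      · simp [List.getLast?_append, ih d (by simpa using hlen) ha hd.2]

theorem IsDyck.head?_eq {p : List Bool} (hp : IsDyck p) (hne : p ≠ []) :
    p.head? = some true := by
  obtain _ | ⟨x, p⟩ := p
  · exact absurd rfl hne
  · have h := hp.2 [x] (by simp)
    cases x <;> simp_all

theorem IsDyck.exists_eq_concat {p : List Bool} (hp : IsDyck p) (hne : p ≠ []) :
    ∃ l, p = l ++ [false] := by
  obtain rfl | ⟨l, x, rfl⟩ := List.eq_nil_or_concat' p
  · exact absurd rfl hne
  · have h := hp.2 l (by simp)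
    have h' := hp.1
    cases x
    · exact ⟨l, rfl⟩
    · simp at h'
      omega

/-- Under `φ`, the Lalanne–Kreweras involution `L` on Dyck `n`-paths corresponds to
reflection of path pairs in a 45° line: the reflection interchanges the two coordinate
directions, swapping `N` steps with `E` steps and interchanging upper and lower paths. -/
theorem phi_lmap_eq_flip (n : ℕ) (hn : 1 ≤ n) (p : List Bool) (hp : IsDyckN n p) :
    phi (Lmap p) = ((phi p).2.map (fun b => !b), (phi p).1.map (fun b => !b)) := by
  have hne : p ≠ [] := by
    rintro rfl
    have := hp.2
    simp at this
    omega
  have hhead := hp.1.head?_eq hne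
  obtain ⟨l, hl⟩ := hp.1.exists_eq_concat hne
  have hlast : p.getLast? = some false := by simp [hl]
  obtain ⟨U, hU⟩ := followBits_eq_concat true p (List.mem_of_mem_head? hhead)
  obtain ⟨V, hV⟩ := followBits_eq_concat false p (by simp [hl])
  have hUn : n = 0 + U.length + 1 := by
    have h := length_followBits true p
    rw [hU, hp.2] at h
    simpa using h.symm
  have hVn : n = 0 + V.length + 1 := by
    have h := length_followBits false p
    rw [hV, ← hp.1.1, hp.2] at h
    simpa using h.symm
  have hcount : V.count true = U.count true := by
    have h := count_false_followBits l
    rw [← hl, hU, hV, hhead] at h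
    have h₁ := List.count_true_add_count_false U
    have h₂ := List.count_true_add_count_false V
    simp at h
    omega
  obtain ⟨ha, ha'⟩ := diffs_truePositions V 0 0 n le_rfl hVn
  obtain ⟨hd, hd'⟩ := diffs_truePositions U 0 0 n le_rfl hUn
  have hL : Lmap p = pathOfRuns
      (List.zipWith (· - ·) (truePositions 0 V ++ [n]) (0 :: (truePositions 0 V ++ [n])))
      (List.zipWith (· - ·) (truePositions 0 U ++ [n]) (0 :: (truePositions 0 U ++ [n]))) := by
    rw [Lmap, lkA_eq, lkD_eq, hU, hV, truePositions_append_false, truePositions_append_false, hp.2]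
    rfl
  have hlen : (List.zipWith (· - ·) (truePositions 0 V ++ [n])
        (0 :: (truePositions 0 V ++ [n]))).length
      = (List.zipWith (· - ·) (truePositions 0 U ++ [n])
        (0 :: (truePositions 0 U ++ [n]))).length := by
    simp [length_truePositions, hcount]
  have hane : List.zipWith (· - ·) (truePositions 0 V ++ [n])
      (0 :: (truePositions 0 V ++ [n])) ≠ [] := by
    simp
  obtain ⟨hLU, hLV⟩ := followBits_pathOfRuns _ _ hlen ha hd
  have hLlast := getLast?_pathOfRuns _ _ hlen hane hd
  have hLhead := head?_pathOfRuns_ne_false _ (List.zipWith (· - ·) (truePositions 0 U ++ [n])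
    (0 :: (truePositions 0 U ++ [n]))) ha
  rw [← hL] at hLU hLV hLlast hLhead
  rw [ha'] at hLU
  rw [hd'] at hLV
  have hLhead' : (Lmap p).head? = some true := by
    rcases h : Lmap p with _ | ⟨_ | _, _⟩ <;> simp_all
  rw [phi_eq_of_head_of_last p V hhead hlast hV, hU,
    phi_eq_of_head_of_last (Lmap p) (U.map fun b => !b) hLhead' hLlast (by simpa using hLV), hLU]
  simp
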